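/- Let (Q,P) be a weakly quasi-lattice ordered group and let Λ be a finitely aligned P-graph (i.e. FA(Λ) = Λ). Then the collection of sets Z_{ℱΛ}(μ;K), where μ ∈ Λ and K ⊆ μΛ is finite, is a basis for the topology on ℱΛ. Moreover, for any μ ∈ Λ and finite K ⊆ μΛ, one has Z_{ℱΛ}(μ;K) = Ê, where E = μΛ ∖ ⋃_{ν∈K} νΛ and Ê = {x ∈ ℱΛ : there is γ ∈ x with x ∩ γΛ ⊆ E}. -/

import Mathlib

set_option autoImplicit false

/-- The topology on the power set `Set α` obtained by identifying it with the
product `∏ _ : α, Prop` where each (two-point) factor `Prop` carries the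
discrete topology. -/
instance powersetTopology (α : Type) : TopologicalSpace (Set α) :=
  @Pi.topologicalSpace α (fun _ => Prop) (fun _ => ⊥)

/-- The cylinder `Z(K₁;K₂) = {x : K₁ ⊆ x ⊆ K₂ᶜ}`. -/
def cylinder {α : Type} (K₁ K₂ : Set α) : Set (Set α) :=
  {x | K₁ ⊆ x ∧ x ⊆ K₂ᶜ}

/-- The relation `p ≤ r` iff `p * q = r` for some `q ∈ P`. -/
def Submonoid.leftLE {Q : Type} [Group Q] (P : Submonoid Q) (p r : Q) : Prop :=
  ∃ q ∈ P, p * q = r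

/-- A weakly quasi-lattice ordered group `(Q,P)`: a group `Q` together with a
subsemigroup `P` containing the unit with `P ∩ P⁻¹ = {e}`, such that any two
elements of `P` with a common upper bound (for `leftLE`) have a least common
upper bound. -/
structure WQLO (Q : Type) [Group Q] where
  P : Submonoid Q
  inter_inv : ∀ p ∈ P, p⁻¹ ∈ P → p = 1
  lub : ∀ a ∈ P, ∀ b ∈ P, (∃ c ∈ P, P.leftLE a c ∧ P.leftLE b c) →
    ∃ l ∈ P, P.leftLE a l ∧ P.leftLE b l ∧
      ∀ c ∈ P, P.leftLE a c → P.leftLE b c → P.leftLE l c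

/-- A (discrete) `P`-graph: a countable small category, presented by its set of
morphisms `Λ` with range map `r`, source map `s` and a composition `mul`
(constrained by the axioms only on composable pairs, i.e. when `s μ = r ν`),
together with a degree functor `d : Λ → P` satisfying the unique factorisation
property. The units of `Λ` are exactly the elements of the form `r lam`. -/
structure PGraph (Q : Type) [Group Q] (W : WQLO Q) where
  Λ : Type
  countable : Countable Λ
  r : Λ → Λ
  s : Λ → Λ
  mul : Λ → Λ → Λ
  d : Λ → Q
  d_mem : ∀ lam, d lam ∈ W.P
  s_r : ∀ lam, s (r lam) = r lam
  r_r : ∀ lam, r (r lam) = r lam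
  s_s : ∀ lam, s (s lam) = s lam
  r_s : ∀ lam, r (s lam) = s lam
  id_mul : ∀ lam, mul (r lam) lam = lam
  mul_id : ∀ lam, mul lam (s lam) = lam
  r_mul : ∀ mu nu, s mu = r nu → r (mul mu nu) = r mu
  s_mul : ∀ mu nu, s mu = r nu → s (mul mu nu) = s nu
  mul_assoc : ∀ mu nu k, s mu = r nu → s nu = r k →
    mul (mul mu nu) k = mul mu (mul nu k)
  d_unit : ∀ lam, d (r lam) = 1
  d_mul : ∀ mu nu, s mu = r nu → d (mul mu nu) = d mu * d nu
  factor : ∀ lam, ∀ p ∈ W.P, ∀ q ∈ W.P, d lam = p * q →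
    ∃! mn : Λ × Λ, s mn.1 = r mn.2 ∧ mul mn.1 mn.2 = lam ∧ d mn.1 = p ∧ d mn.2 = q

namespace PGraph

variable {Q : Type} [Group Q] {W : WQLO Q} (G : PGraph Q W)

/-- `λΛ = {λμ : μ ∈ Λ, s λ = r μ}`. -/
def cone (lam : G.Λ) : Set G.Λ :=
  {x | ∃ mu, G.s lam = G.r mu ∧ x = G.mul lam mu}

/-- `λE = {λμ : μ ∈ E, s λ = r μ}`. -/
def coneSet (lam : G.Λ) (E : Set G.Λ) : Set G.Λ :=
  {x | ∃ mu ∈ E, G.s lam = G.r mu ∧ x = G.mul lam mu}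

/-- `Λ` is finitely aligned at the pair `(μ,ν)`. -/
def FinAlignedAtPair (mu nu : G.Λ) : Prop :=
  ∃ J : Finset G.Λ, G.cone mu ∩ G.cone nu = ⋃ lam ∈ (J : Set G.Λ), G.cone lam

/-- `Λ` is finitely aligned at `λ`. -/
def FinAlignedAt (lam : G.Λ) : Prop :=
  ∀ mu ∈ G.cone lam, ∀ nu : G.Λ, G.FinAlignedAtPair mu nu

/-- The finitely aligned part `FA(Λ)`. -/
def FA : Set G.Λ := {lam | G.FinAlignedAt lam}

/-- `FAr(Λ) = FA(Λ) ∪ r(FA(Λ))`. -/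
def FAr : Set G.Λ := G.FA ∪ G.r '' G.FA

/-- `μ ≼ λ` iff `μν = λ` for some `ν`. -/
def pre (mu lam : G.Λ) : Prop :=
  ∃ nu, G.s mu = G.r nu ∧ G.mul mu nu = lam

/-- A filter: a nonempty, hereditary and directed subset of `Λ`. -/
def IsFilter (x : Set G.Λ) : Prop :=
  x.Nonempty ∧ (∀ lam mu, G.pre lam mu → mu ∈ x → lam ∈ x) ∧
    ∀ mu ∈ x, ∀ nu ∈ x, ∃ lam ∈ x, G.pre mu lam ∧ G.pre nu lam

/-- The space `ℱΛ` of filters, with the subspace topology from `𝒫(Λ)`. -/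
abbrev FilterSpace := {x : Set G.Λ // G.IsFilter x}

/-- `Z_{ℱΛ}(μ;K) = {x ∈ ℱΛ : μ ∈ x ⊆ Λ∖K}`. -/
def Zf (mu : G.Λ) (K : Set G.Λ) : Set G.FilterSpace :=
  {x | mu ∈ x.1 ∧ x.1 ⊆ Kᶜ}

/-- An ultrafilter: a filter maximal with respect to inclusion. -/
def IsUltrafilter (x : Set G.Λ) : Prop :=
  G.IsFilter x ∧ ∀ y, G.IsFilter y → x ⊆ y → x = y

/-- The path space `PS(Λ)`: filters meeting `FA(Λ)` (as a set of subsets). -/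
def PS : Set (Set G.Λ) := {x | G.IsFilter x ∧ (x ∩ G.FA).Nonempty}

/-- The path space as a topological space (subspace of `𝒫(Λ)`). -/
abbrev PSpace := {x : Set G.Λ // x ∈ G.PS}

/-- The boundary-path space: the closure in `PS(Λ)` of the set of ultrafilters
lying in `PS(Λ)`. -/
def BPS : Set G.PSpace := closure {x : G.PSpace | G.IsUltrafilter x.1}

abbrev BPSpace := {x : G.PSpace // x ∈ G.BPS}

/-- The left shift `λ⁻¹·x = {μ : λμ ∈ x}`. -/
def lshift (lam : G.Λ) (x : Set G.Λ) : Set G.Λ :=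
  {mu | G.s lam = G.r mu ∧ G.mul lam mu ∈ x}

/-- The right shift `λ·x = {ζ : ζ ≼ λμ for some μ ∈ x}`. -/
def rshift (lam : G.Λ) (x : Set G.Λ) : Set G.Λ :=
  {z | ∃ mu ∈ x, G.s lam = G.r mu ∧ G.pre z (G.mul lam mu)}

/-- The action `x·m`: the left shift of `x` by the unique element of
`x ∩ Λ^m` (when it exists). -/
def act (x : Set G.Λ) (m : Q) : Set G.Λ :=
  ⋃ lam ∈ {l ∈ x | G.d l = m}, G.lshift lam x

/-- The domain `D_m = {x ∈ PS(Λ) : x ∩ Λ^m ≠ ∅}` of `T_m`. -/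
def Dom (m : Q) : Set (Set G.Λ) := {x ∈ G.PS | ∃ l ∈ x, G.d l = m}

/-- The range `R_m = {x·m : x ∈ D_m}` of `T_m`. -/
def Ran (m : Q) : Set (Set G.Λ) := {y | ∃ x ∈ G.Dom m, G.act x m = y}

end PGraph
namespace PGraph

variable {Q : Type} [Group Q] {W : WQLO Q} (G : PGraph Q W)

theorem mem_cone_iff_pre {mu lam : G.Λ} : lam ∈ G.cone mu ↔ G.pre mu lam :=
  ⟨fun ⟨nu, h, e⟩ => ⟨nu, h, e.symm⟩, fun ⟨nu, h, e⟩ => ⟨nu, h, e.symm⟩⟩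

theorem pre_refl (mu : G.Λ) : G.pre mu mu :=
  ⟨G.s mu, (G.r_s mu).symm, G.mul_id mu⟩

theorem pre_trans {a b c : G.Λ} (hab : G.pre a b) (hbc : G.pre b c) : G.pre a c := by
  obtain ⟨m, hm, rfl⟩ := hab
  obtain ⟨n, hn, rfl⟩ := hbc
  rw [G.s_mul a m hm] at hn
  exact ⟨G.mul m n, by rw [G.r_mul m n hn, hm], (G.mul_assoc a m n hm hn).symm⟩

theorem mem_cone_self (mu : G.Λ) : mu ∈ G.cone mu :=
  G.mem_cone_iff_pre.2 (G.pre_refl mu)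

variable {G}

namespace IsFilter

variable {x : Set G.Λ}

theorem mem_of_mem_cone (hx : G.IsFilter x) {mu lam : G.Λ} (h : lam ∈ G.cone mu) (hl : lam ∈ x) : mu ∈ x :=
  hx.2.1 mu lam (G.mem_cone_iff_pre.1 h) hl

theorem exists_mem_cone_inter (hx : G.IsFilter x) {mu nu : G.Λ} (hm : mu ∈ x) (hn : nu ∈ x) :
    ∃ lam ∈ x, lam ∈ G.cone mu ∩ G.cone nu := by
  obtain ⟨lam, hl, h1, h2⟩ := hx.2.2 mu hm nu hn
  exact ⟨lam, hl, G.mem_cone_iff_pre.2 h1, G.mem_cone_iff_pre.2 h2⟩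

theorem exists_upperBound (hx : G.IsFilter x) (I : Finset G.Λ) :
    ∃ mu ∈ x, ∀ a ∈ I, a ∈ x → G.pre a mu := by
  classical
  induction I using Finset.induction_on with
  | empty =>
    obtain ⟨m, hm⟩ := hx.1
    exact ⟨m, hm, by simp⟩
  | insert a I _ ih =>
    obtain ⟨m, hm, h⟩ := ih
    by_cases ha : a ∈ x
    · obtain ⟨l, hl, h1, h2⟩ := hx.2.2 m hm a ha
      refine ⟨l, hl, fun b hb hbx => ?_⟩
      rcases Finset.mem_insert.1 hb with rfl | hb
      · exact h2
      · exact G.pre_trans (h b hb hbx) h1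
    · refine ⟨m, hm, fun b hb hbx => ?_⟩
      rcases Finset.mem_insert.1 hb with rfl | hb
      · exact absurd hbx ha
      · exact h b hb hbx

end IsFilter

theorem isOpen_setOf_mem (mu : G.Λ) (p : Prop → Prop) :
    IsOpen {x : G.FilterSpace | p (mu ∈ x.1)} := by
  have h : @IsOpen (Set G.Λ) _ {f : Set G.Λ | p (mu ∈ f)} :=
    (@continuous_def _ _ (powersetTopology G.Λ) ⊥ _).1
      (@continuous_apply G.Λ (fun _ => Prop) (fun _ => ⊥) mu) {q | p q} trivial
  exact h.preimage continuous_subtype_val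

theorem isOpen_Zf (mu : G.Λ) (K : Finset G.Λ) : IsOpen (G.Zf mu (K : Set G.Λ)) := by
  have h : G.Zf mu (K : Set G.Λ) =
      {x : G.FilterSpace | mu ∈ x.1} ∩ ⋂ k ∈ K, {x : G.FilterSpace | ¬ k ∈ x.1} := by
    ext x
    simp only [Zf, Set.mem_ofPred_eq, Set.mem_inter_iff, Set.mem_iInter, Set.subset_def,
      Set.mem_compl_iff, Finset.mem_coe]
    exact and_congr_right fun _ => ⟨fun h k hk hx => h k hx hk, fun h k hx hk => h k hk hx⟩
  rw [h]
  exact (isOpen_setOf_mem mu id).inter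
    (isOpen_biInter_finset fun k _ => isOpen_setOf_mem k Not)

theorem exists_finset_of_isOpen {U : Set G.FilterSpace} (hU : IsOpen U) {x : G.FilterSpace}
    (hx : x ∈ U) :
    ∃ I : Finset G.Λ, ∀ y : G.FilterSpace, (∀ a ∈ I, a ∈ y.1 ↔ a ∈ x.1) → y ∈ U := by
  obtain ⟨V, hV, rfl⟩ := isOpen_induced_iff.1 hU
  obtain ⟨I, u, hu, hI⟩ := (@isOpen_pi_iff G.Λ (fun _ => Prop) (fun _ => ⊥) V).1 hV x.1 hx
  refine ⟨I, fun y hy => hI fun a ha => ?_⟩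
  have e : y.1 a = x.1 a := propext (hy a ha)
  rw [e]
  exact (hu a ha).2

/-- At a finitely aligned `mu`, finitely many exclusions can be moved into the cone of `mu`. -/
theorem exists_finset_subset_cone {mu : G.Λ} (hmu : mu ∈ G.FA) (I : Finset G.Λ) :
    ∃ K : Finset G.Λ, (K : Set G.Λ) ⊆ G.cone mu ∧
      G.Zf mu (K : Set G.Λ) = G.Zf mu (I : Set G.Λ) := by
  classical
  choose J hJ using hmu mu (G.mem_cone_self mu)
  have hJ' (nu) {lam} (h : lam ∈ J nu) : lam ∈ G.cone mu ∩ G.cone nu := by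
    rw [hJ nu]
    exact Set.mem_biUnion (Finset.mem_coe.2 h) (G.mem_cone_self lam)
  refine ⟨I.biUnion J, fun lam h => ?_, ?_⟩
  · obtain ⟨nu, -, h⟩ := Finset.mem_biUnion.1 (Finset.mem_coe.1 h)
    exact (hJ' nu h).1
  · ext x
    refine and_congr_right fun hm => ⟨fun h nu hnu hI => ?_, fun h lam hl hK => ?_⟩
    · obtain ⟨z, hz, hzc⟩ := x.2.exists_mem_cone_inter hm hnu
      rw [hJ nu] at hzc
      obtain ⟨lam, hlam, hzl⟩ := Set.mem_iUnion₂.1 hzc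
      exact h (x.2.mem_of_mem_cone hzl hz)
        (Finset.mem_coe.2 (Finset.mem_biUnion.2 ⟨nu, hI, hlam⟩))
    · obtain ⟨nu, hnu, hlam⟩ := Finset.mem_biUnion.1 (Finset.mem_coe.1 hK)
      exact h (x.2.mem_of_mem_cone (hJ' nu hlam).2 hl) hnu

theorem Zf_eq_setOf_inter_cone_subset (mu : G.Λ) (K : Set G.Λ) :
    G.Zf mu K = {x : G.FilterSpace | ∃ gam ∈ x.1,
      x.1 ∩ G.cone gam ⊆ G.cone mu \ ⋃ nu ∈ K, G.cone nu} := by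
  ext x
  constructor
  · rintro ⟨hm, hK⟩
    refine ⟨mu, hm, fun z hz => ⟨hz.2, fun hzK => ?_⟩⟩
    obtain ⟨nu, hnu, hznu⟩ := Set.mem_iUnion₂.1 hzK
    exact hK (x.2.mem_of_mem_cone hznu hz.1) hnu
  · rintro ⟨gam, hg, h⟩
    refine ⟨x.2.mem_of_mem_cone (h ⟨hg, G.mem_cone_self gam⟩).1 hg, fun nu hnu hK => ?_⟩
    obtain ⟨z, hz, hzg, hzn⟩ := x.2.exists_mem_cone_inter hg hnu
    exact (h ⟨hz, hzg⟩).2 (Set.mem_biUnion hK hzn)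

end PGraph

/-- If `Λ` is finitely aligned (`FA(Λ) = Λ`), the sets `Z_{ℱΛ}(μ;K)` with
`μ ∈ Λ` and `K ⊆ μΛ` finite form a basis for the topology on `ℱΛ`; moreover
for such `μ, K` one has `Z_{ℱΛ}(μ;K) = Ê` where `E = μΛ ∖ ⋃_{ν∈K} νΛ` and
`Ê = {x ∈ ℱΛ : ∃ γ ∈ x, x ∩ γΛ ⊆ E}`. -/
theorem statement19 {Q : Type} [Group Q] {W : WQLO Q} (G : PGraph Q W)
    (hfa : ∀ lam : G.Λ, lam ∈ G.FA) :
    TopologicalSpace.IsTopologicalBasis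
      {U : Set G.FilterSpace | ∃ mu : G.Λ, ∃ K : Finset G.Λ,
        (K : Set G.Λ) ⊆ G.cone mu ∧ U = G.Zf mu (K : Set G.Λ)} ∧
    ∀ mu : G.Λ, ∀ K : Finset G.Λ, (K : Set G.Λ) ⊆ G.cone mu →
      G.Zf mu (K : Set G.Λ) =
        {x : G.FilterSpace | ∃ gam ∈ x.1,
          x.1 ∩ G.cone gam ⊆ G.cone mu \ ⋃ nu ∈ (K : Set G.Λ), G.cone nu} := by
  classical
  refine ⟨TopologicalSpace.isTopologicalBasis_of_isOpen_of_nhds ?_ ?_,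
    fun mu K _ => PGraph.Zf_eq_setOf_inter_cone_subset mu K⟩
  · rintro _ ⟨mu, K, -, rfl⟩
    exact PGraph.isOpen_Zf mu K
  · intro x U hx hU
    obtain ⟨I, hI⟩ := PGraph.exists_finset_of_isOpen hU hx
    obtain ⟨mu, hm, hub⟩ := x.2.exists_upperBound I
    obtain ⟨K, hK, hKI⟩ :=
      PGraph.exists_finset_subset_cone (hfa mu) (I.filter fun a => a ∉ x.1)
    refine ⟨_, ⟨mu, K, hK, rfl⟩, ?_, ?_⟩
    · rw [hKI]
      exact ⟨hm, fun a ha hI => (Finset.mem_filter.1 (Finset.mem_coe.1 hI)).2 ha⟩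
    · rw [hKI]
      rintro y ⟨hmy, hy⟩
      refine hI y fun a ha => ⟨fun hay => ?_, fun hax => y.2.2.1 a mu (hub a ha hax) hmy⟩
      by_contra hax
      exact hy hay (Finset.mem_coe.2 (Finset.mem_filter.2 ⟨ha, hax⟩))
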